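/- The renormalized energy of periodic configurations: Let d ≥ 2, N a positive integer, and let L ⊂ ℝ^d be a full-rank lattice with basis v_1,…,v_d and covolume |det(v_1,…,v_d)| = N; let D = { Σ t_i v_i : t_i ∈ [0,1) } be the fundamental parallelepiped. Let G : ℝ^d ∖ L → ℝ be L-periodic and C², with ΔG = 1/N on ℝ^d ∖ L, with ∫_D G = 0, and such that for some δ > 0 there is a C¹ function R̃ on B(0,δ) with G(x) = c_d^{−1} w(x) + R̃(x) for 0 < |x| < δ. Let a_1,…,a_N ∈ ℝ^d be pairwise distinct modulo L, and set h(x) = c_d Σ_{i=1}^N G(x − a_i). Then lim_{η→0} ( ∫_{D ∖ ⋃_{i=1}^N ⋃_{v∈L} B(a_i + v, η)} |∇h|² dx − N c_d w(η) ) = c_d² Σ_{i≠j} G(a_i − a_j) + c_d² N R̃(0). -/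

import Mathlib

open MeasureTheory Metric Real Filter
open scoped Topology ENNReal BigOperators

noncomputable section

/-- Euclidean space `ℝ^d`. -/
abbrev Euc (d : ℕ) := EuclideanSpace ℝ (Fin d)

/-- The Coulomb kernel `w` : `|x|^{2-d}` for `d ≥ 3`, `-log |x|` for `d = 2`. -/
def ck (d : ℕ) (x : Euc d) : ℝ :=
  if d = 2 then -Real.log ‖x‖ else ‖x‖ ^ ((2 : ℝ) - d)

/-- The Coulomb kernel as a function of the radius. -/
def ckr (d : ℕ) (r : ℝ) : ℝ :=
  if d = 2 then -Real.log r else r ^ ((2 : ℝ) - d)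

/-- The constant `c_d`: `2π` for `d = 2` and `(d−2)|S^{d−1}|` for `d ≥ 3`
(using `|S^{d-1}| = d · |B(0,1)|`). -/
def cConst (d : ℕ) : ℝ :=
  if d = 2 then 2 * π
  else ((d : ℝ) - 2) * d * (volume (ball (0 : Euc d) 1)).toReal

/-- The lattice generated by the basis `v`. -/
def lat (d : ℕ) (v : Fin d → Euc d) : Set (Euc d) :=
  Set.range fun m : Fin d → ℤ => ∑ i, (m i : ℝ) • v i

/-- The fundamental parallelepiped `D = {Σ tᵢ vᵢ : tᵢ ∈ [0,1)}`. -/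
def fundDomain (d : ℕ) (v : Fin d → Euc d) : Set (Euc d) :=
  (fun t : Fin d → ℝ => ∑ i, t i • v i) '' Set.pi Set.univ (fun _ => Set.Ico (0:ℝ) 1)

/-- The prefactor of the radial derivative of the Coulomb kernel. -/
def slopeConst (d : ℕ) : ℝ := if d = 2 then 1 else (d : ℝ) - 2

/-- Minus the radial derivative of the Coulomb kernel. -/
def ckSlope (d : ℕ) (r : ℝ) : ℝ := slopeConst d / r ^ (d - 1)

lemma nontrivial_euc {d : ℕ} (hd : 2 ≤ d) : Nontrivial (Euc d) := by
  have : Nonempty (Fin d) := ⟨⟨0, by omega⟩⟩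
  infer_instance

lemma slopeConst_pos {d : ℕ} (hd : 2 ≤ d) : 0 < slopeConst d := by
  unfold slopeConst
  split_ifs with h
  · norm_num
  · have : (3 : ℝ) ≤ d := by exact_mod_cast (by omega : 3 ≤ d)
    linarith

lemma ckSlope_pos {d : ℕ} (hd : 2 ≤ d) {r : ℝ} (hr : 0 < r) : 0 < ckSlope d r :=
  div_pos (slopeConst_pos hd) (pow_pos hr _)

lemma cConst_eq (d : ℕ) :
    cConst d = slopeConst d * (d * (volume : Measure (Euc d)).real (ball 0 1)) := by
  unfold cConst slopeConst Measure.real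
  split_ifs with h
  · subst h
    rw [EuclideanSpace.volume_ball_fin_two]
    simp [ENNReal.toReal_ofReal pi_pos.le]
  · ring

lemma cConst_pos {d : ℕ} (hd : 2 ≤ d) : 0 < cConst d := by
  rw [cConst_eq]
  have h1 : (0 : ℝ) < d := by exact_mod_cast (by omega : 0 < d)
  have h2 : 0 < (volume : Measure (Euc d)).real (ball 0 1) :=
    ENNReal.toReal_pos (measure_ball_pos _ _ one_pos).ne' measure_ball_lt_top.ne
  have := slopeConst_pos hd
  positivity

lemma hasDerivAt_ckr {d : ℕ} (hd : 2 ≤ d) {r : ℝ} (hr : 0 < r) :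
    HasDerivAt (ckr d) (-ckSlope d r) r := by
  unfold ckSlope slopeConst
  by_cases h : d = 2
  · have : ckr d = fun r => -Real.log r := by ext; simp [ckr, h]
    rw [this]
    refine (Real.hasDerivAt_log hr.ne').neg.congr_deriv ?_
    simp [h]
  · have : ckr d = fun r => r ^ ((2 : ℝ) - d) := by ext; simp [ckr, h]
    rw [this]
    convert (Real.hasDerivAt_rpow_const (p := (2 : ℝ) - d) (Or.inl hr.ne')) using 1
    have e : (2 : ℝ) - d - 1 = -((d - 1 : ℕ) : ℝ) := by
      rw [Nat.cast_sub (by omega)]; push_cast; ring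
    rw [e, Real.rpow_neg hr.le, Real.rpow_natCast]
    rw [if_neg h]
    field_simp
    ring

lemma ckr_antitoneOn {d : ℕ} (hd : 2 ≤ d) : AntitoneOn (ckr d) (Set.Ioi 0) := by
  refine antitoneOn_of_deriv_nonpos (convex_Ioi 0) ?_ ?_ ?_
  · exact fun x hx => (hasDerivAt_ckr hd hx).continuousAt.continuousWithinAt
  · rw [interior_Ioi]
    exact fun x hx => (hasDerivAt_ckr hd hx).differentiableAt.differentiableWithinAt
  · rw [interior_Ioi]
    intro x hx
    rw [(hasDerivAt_ckr hd hx).deriv]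
    exact neg_nonpos.2 (ckSlope_pos hd hx).le

lemma ck_eq_ckr_norm (d : ℕ) (x : Euc d) : ck d x = ckr d ‖x‖ := rfl

lemma tendsto_inv_ckSlope {d : ℕ} (hd : 2 ≤ d) :
    Tendsto (fun r => (ckSlope d r)⁻¹) (𝓝[>] 0) (𝓝 0) := by
  have : (fun r => (ckSlope d r)⁻¹) = fun r : ℝ => r ^ (d - 1) / slopeConst d := by
    ext r; simp [ckSlope]
  rw [this]
  have h : ContinuousAt (fun r : ℝ => r ^ (d - 1) / slopeConst d) 0 := by fun_prop
  have h2 := h.tendsto.mono_left (nhdsWithin_le_nhds (s := Set.Ioi 0))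
  simpa [show d - 1 ≠ 0 by omega] using h2

lemma tendsto_pow_mul_ckr {d : ℕ} (hd : 2 ≤ d) :
    Tendsto (fun r => r ^ (d - 1) * ckr d r) (𝓝[>] 0) (𝓝 0) := by
  by_cases h : d = 2
  · subst h
    have := tendsto_log_mul_rpow_nhdsGT_zero (r := 1) one_pos
    have h2 := this.neg
    rw [neg_zero] at h2
    refine h2.congr fun r => ?_
    simp [ckr]; ring
  · have h0 : Tendsto (fun r : ℝ => r) (𝓝[>] 0) (𝓝 0) := tendsto_id.mono_left nhdsWithin_le_nhds
    refine h0.congr' ?_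
    filter_upwards [self_mem_nhdsWithin] with r hr
    have hr : 0 < r := hr
    simp only [ckr, h, if_false]
    rw [← Real.rpow_natCast, ← Real.rpow_add hr, Nat.cast_sub (by omega)]
    push_cast
    rw [show (d : ℝ) - 1 + (2 - d) = 1 by ring, Real.rpow_one]

lemma tendsto_ckr_mul_inv_ckSlope {d : ℕ} (hd : 2 ≤ d) :
    Tendsto (fun r => ckr d r * (ckSlope d r)⁻¹) (𝓝[>] 0) (𝓝 0) := by
  have := (tendsto_pow_mul_ckr hd).div_const (slopeConst d)
  rw [zero_div] at this
  refine this.congr fun r => ?_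
  simp [ckSlope]; ring

lemma integrableOn_ck {d : ℕ} (hd : 2 ≤ d) :
    ∃ ρ > 0, IntegrableOn (ck d) (ball 0 ρ) := by
  have := nontrivial_euc hd
  obtain ⟨ρ, hρ, hb⟩ : ∃ ρ > 0, ∀ r ∈ Set.Ioo 0 ρ, |r ^ (d - 1) * ckr d r| ≤ 1 := by
    have := (tendsto_pow_mul_ckr hd).eventually (Metric.closedBall_mem_nhds 0 one_pos)
    obtain ⟨ρ, hρ, h⟩ := mem_nhdsGT_iff_exists_Ioo_subset.1 this
    refine ⟨ρ, hρ, fun r hr => ?_⟩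
    simpa using h hr
  refine ⟨ρ, hρ, ?_⟩
  rw [← integrable_indicator_iff measurableSet_ball]
  have e : (ball (0 : Euc d) ρ).indicator (ck d)
      = fun x => (Set.Iio ρ).indicator (ckr d) ‖x‖ := by
    ext x
    by_cases hx : ‖x‖ < ρ
    · rw [Set.indicator_of_mem (by simpa using hx), Set.indicator_of_mem (by simpa using hx),
        ck_eq_ckr_norm]
    · rw [Set.indicator_of_notMem (by simpa using hx), Set.indicator_of_notMem (by simpa using hx)]
  have hm : Measurable (ckr d) := by
    unfold ckr
    split_ifs
    · fun_prop
    · fun_prop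
  rw [e, integrable_fun_norm_addHaar volume, finrank_euclideanSpace, Fintype.card_fin]
  have : IntegrableOn (fun _ : ℝ => (1 : ℝ)) (Set.Ioo 0 ρ) := by simp
  have h2 := (integrable_indicator_iff measurableSet_Ioo).2 this
  refine (h2.integrableOn (s := Set.Ioi 0)).mono' ?_ ?_
  · exact ((measurable_id.pow_const _).smul (hm.indicator measurableSet_Iio)).aestronglyMeasurable
  · filter_upwards [ae_restrict_mem measurableSet_Ioi] with r hr
    by_cases h : r < ρ
    · rw [Set.indicator_of_mem (by simpa using h),
        Set.indicator_of_mem (show r ∈ Set.Ioo 0 ρ from ⟨hr, h⟩)]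
      exact hb r ⟨hr, h⟩
    · rw [Set.indicator_of_notMem (by simpa using h), Set.indicator_of_notMem (by simp [h])]
      simp

lemma exists_ramp {s t : ℝ} (hst : s < t) :
    ∃ T : ℝ → ℝ, ContDiff ℝ 1 T ∧ Monotone T ∧ (∀ r ≤ s, T r = 0) ∧ (∀ r, t ≤ r → T r = 1) := by
  have hp : 0 < t - s := sub_pos.2 hst
  refine ⟨fun r => Real.smoothTransition ((r - s) / (t - s)), ?_, ?_, ?_, ?_⟩
  · exact Real.smoothTransition.contDiff.comp (by fun_prop)
  · intro x y hxy
    exact Real.smoothTransition.monotone (by gcongr)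
  · intro r hr
    exact Real.smoothTransition.zero_of_nonpos
      (div_nonpos_of_nonpos_of_nonneg (by linarith) hp.le)
  · intro r hr
    exact Real.smoothTransition.one_of_one_le (by rw [le_div_iff₀ hp]; linarith)

lemma integral_deriv_ramp_mul_ckSlope {d : ℕ} (hd : 2 ≤ d) {s t : ℝ} (hs : 0 < s) {T : ℝ → ℝ}
    (hT : ContDiff ℝ 1 T) (hTm : Monotone T)
    (hT0 : ∀ r ≤ s, T r = 0) (hT1 : ∀ r, t ≤ r → T r = 1) :
    ∫ x : Euc d, deriv T ‖x‖ * ckSlope d ‖x‖ = cConst d := by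
  have := nontrivial_euc hd
  rw [integral_fun_norm_addHaar volume (fun r => deriv T r * ckSlope d r), cConst_eq,
    finrank_euclideanSpace, Fintype.card_fin]
  have h1 : ∫ r in Set.Ioi (0 : ℝ), deriv T r = 1 := by
    have := integral_Ioi_of_hasDerivAt_of_nonneg' (g := T) (g' := deriv T) (a := 0) (l := 1)
      (fun x _ => (hT.differentiable one_ne_zero x).hasDerivAt) (fun x _ => hTm.deriv_nonneg)
      (tendsto_const_nhds.congr' (by
        filter_upwards [eventually_ge_atTop t] with r hr using (hT1 r hr).symm))
    rw [this, hT0 0 hs.le, sub_zero]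
  have h2 : ∫ r in Set.Ioi (0 : ℝ), r ^ (d - 1) • (deriv T r * ckSlope d r) = slopeConst d := by
    rw [← mul_one (slopeConst d), ← h1, ← integral_const_mul]
    refine setIntegral_congr_fun measurableSet_Ioi fun r hr => ?_
    have hr : 0 < r := hr
    have : r ^ (d - 1) ≠ 0 := (pow_pos hr _).ne'
    simp only [ckSlope, smul_eq_mul]
    field_simp
  rw [h2]
  simp only [smul_eq_mul, nsmul_eq_mul]
  ring

section Periodic

open scoped Pointwise

variable {d : ℕ} {L : AddSubgroup (Euc d)} {D : Set (Euc d)}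

lemma setIntegral_add_right_of_periodic [Countable L] (hD : IsAddFundamentalDomain L D volume)
    {f : Euc d → ℝ} (hf : ∀ x, ∀ p ∈ L, f (x + p) = f x) (t : Euc d) :
    ∫ x in D, f (x + t) = ∫ x in D, f x := by
  have h1 := hD.vadd_of_comm t
  have hper : ∀ (g : L) (x : Euc d), f (g +ᵥ x) = f x := by
    intro g x
    rw [show g +ᵥ x = x + g from add_comm _ _]
    exact hf x g g.2
  rw [hD.setIntegral_eq h1 hper]
  have hmp : MeasurePreserving (fun x : Euc d => x + t) volume volume :=
    measurePreserving_add_right volume t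
  rw [← hmp.setIntegral_preimage_emb (measurableEmbedding_addRight t) f (t +ᵥ D)]
  congr 2
  ext x
  rw [Set.mem_preimage, add_comm x t, ← vadd_eq_add, Set.vadd_mem_vadd_set_iff]

lemma setIntegral_fderiv_eq_zero_of_periodic [Countable L]
    (hD : IsAddFundamentalDomain L D volume) (hDb : Bornology.IsBounded D)
    {f : Euc d → ℝ} (hf : ∀ x, ∀ p ∈ L, f (x + p) = f x) (hC : ContDiff ℝ 1 f) (e : Euc d) :
    ∫ x in D, fderiv ℝ f x e = 0 := by
  obtain ⟨R, hR⟩ := hDb.subset_closedBall 0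
  have hcont : Continuous fun x => fderiv ℝ f x e :=
    (hC.continuous_fderiv one_ne_zero).clm_apply continuous_const
  obtain ⟨C, hCb⟩ := (isCompact_closedBall (0 : Euc d) (R + ‖e‖)).exists_bound_of_continuousOn
    hcont.continuousOn
  have hint : ∀ {g : Euc d → ℝ}, Continuous g → IntegrableOn g D := fun hg =>
    (hg.continuousOn.integrableOn_compact (isCompact_closedBall 0 R)).mono_set hR
  have hDfin : volume D < ⊤ := hDb.measure_lt_top
  have key := hasDerivAt_integral_of_dominated_loc_of_deriv_le (𝕜 := ℝ)
    (μ := volume.restrict D) (F := fun t x => f (x + t • e))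
    (F' := fun t x => fderiv ℝ f (x + t • e) e) (x₀ := 0) (s := ball 0 1) (bound := fun _ => C)
    (ball_mem_nhds 0 one_pos)
    (Eventually.of_forall fun t =>
      (hC.continuous.comp (by fun_prop : Continuous fun x => x + t • e)).aestronglyMeasurable)
    (hint (hC.continuous.comp (by fun_prop)))
    ((hcont.comp (by fun_prop : Continuous fun x => x + (0 : ℝ) • e)).aestronglyMeasurable)
    (by
      have hae : ∀ᵐ x ∂(volume.restrict D), x ∈ closedBall (0 : Euc d) R :=
        ae_restrict_of_ae_restrict_of_subset hR (ae_restrict_mem measurableSet_closedBall)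
      filter_upwards [hae] with x hx t ht
      apply hCb
      rw [mem_closedBall_zero_iff] at hx ⊢
      refine (norm_add_le _ _).trans (add_le_add hx ?_)
      rw [norm_smul]
      have : ‖t‖ ≤ 1 := (mem_ball_zero_iff.1 ht).le
      nlinarith [norm_nonneg e])
    (integrableOn_const hDfin.ne)
    (Eventually.of_forall fun x t _ => by
      have h1 : HasFDerivAt f (fderiv ℝ f (x + t • e)) (x + t • e) :=
        (hC.differentiable one_ne_zero _).hasFDerivAt
      have h2 : HasDerivAt (fun t : ℝ => x + t • e) e t := by
        simpa using ((hasDerivAt_id t).smul_const e).const_add x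
      exact h1.comp_hasDerivAt t h2)
  have hconst : (fun t : ℝ => ∫ x in D, f (x + t • e)) = fun _ => ∫ x in D, f x := by
    ext t
    exact setIntegral_add_right_of_periodic hD hf _
  have h3 := key.2
  rw [hconst] at h3
  have h4 := h3.unique (hasDerivAt_const 0 _)
  simpa using h4

lemma setIntegral_eq_of_periodic_of_support [Countable L]
    (hD : IsAddFundamentalDomain L D volume) (hDm : MeasurableSet D)
    {f : Euc d → ℝ} (hf : ∀ x, ∀ p ∈ L, f (x + p) = f x)
    {S : Set (Euc d)} (hSm : MeasurableSet S)
    (hdisj : ∀ x ∈ S, ∀ p ∈ L, x + p ∈ S → p = 0)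
    (hsupp : ∀ x, f x ≠ 0 → ∃ p ∈ L, x + p ∈ S)
    (hfS : IntegrableOn f S) (hfD : IntegrableOn f D) :
    ∫ x in D, f x = ∫ x in S, f x := by
  have hmem : ∀ (g : L) (x : Euc d), x ∈ g +ᵥ S ↔ x + (-(g : Euc d)) ∈ S := by
    intro g x
    rw [Set.mem_vadd_set_iff_neg_vadd_mem, show -g +ᵥ x = x + (-(g : Euc d)) from add_comm _ _]
  rw [hD.setIntegral_eq_tsum' hfS]
  have hper : ∀ (g : L) (x : Euc d), f (-g +ᵥ x) = f x := by
    intro g x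
    rw [show -g +ᵥ x = x + (-(g : Euc d)) from add_comm _ _]
    exact hf x _ (neg_mem g.2)
  simp only [hper]
  have hm : ∀ g : L, MeasurableSet ((g +ᵥ S) ∩ D) := fun g => (hSm.const_vadd g).inter hDm
  rw [← integral_iUnion hm]
  · rw [← Set.iUnion_inter]
    apply setIntegral_eq_of_subset_of_forall_sdiff_eq_zero hDm Set.inter_subset_right
    rintro x ⟨hxD, hx⟩
    by_contra h0
    obtain ⟨p, hp, hxp⟩ := hsupp x h0
    refine hx ⟨Set.mem_iUnion.2 ⟨-⟨p, hp⟩, ?_⟩, hxD⟩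
    rw [hmem]
    simpa using hxp
  · intro g g' hgg'
    rw [Function.onFun, Set.disjoint_left]
    rintro x ⟨hx, -⟩ ⟨hx', -⟩
    rw [hmem] at hx hx'
    have := hdisj _ hx ((g : Euc d) - g') (sub_mem g.2 g'.2) (by
      convert hx' using 1; abel)
    exact hgg' (Subtype.ext (sub_eq_zero.1 this))
  · exact hfD.mono_set (by rw [← Set.iUnion_inter]; exact Set.inter_subset_right)

end Periodic

section Cutoff

variable {d : ℕ} {P : Set (Euc d)} {r₀ : ℝ}

lemma infDist_eq_dist_of_dist_lt (hsep : P.Pairwise fun p q => 2 * r₀ ≤ dist p q)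
    {q x : Euc d} (hq : q ∈ P) (hx : dist x q < r₀) : infDist x P = dist x q := by
  refine le_antisymm (infDist_le_dist_of_mem hq) ((le_infDist ⟨q, hq⟩).2 fun p hp => ?_)
  rcases eq_or_ne p q with rfl | hpq
  · exact le_rfl
  · have h1 := hsep hp hq hpq
    have h2 := dist_triangle_left p q x
    linarith

lemma exists_dist_lt_of_infDist_lt (hP : P.Nonempty) {x : Euc d} (hx : infDist x P < r₀) :
    ∃ q ∈ P, dist x q < r₀ :=
  (infDist_lt_iff hP).1 hx

lemma hasFDerivAt_norm_of_ne_zero {y : Euc d} (hy : y ≠ 0) :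
    HasFDerivAt (fun x : Euc d => ‖x‖) (‖y‖⁻¹ • innerSL ℝ y) y := by
  have h1 := (hasStrictFDerivAt_norm_sq (F := Euc d) y).hasFDerivAt
  have hn : ‖y‖ ≠ 0 := norm_ne_zero_iff.2 hy
  have h2 := h1.sqrt (pow_ne_zero 2 hn)
  have e : (fun x : Euc d => √(‖x‖ ^ 2)) = fun x => ‖x‖ := by
    ext x; exact Real.sqrt_sq (norm_nonneg x)
  rw [e, Real.sqrt_sq (norm_nonneg y)] at h2
  refine h2.congr_fderiv ?_
  ext z
  simp
  field_simp

variable {s t : ℝ} {T : ℝ → ℝ}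

lemma eventually_cutoff_eq_zero (hs : 0 < s) (hT0 : ∀ r ≤ s, T r = 0) {q : Euc d} (hq : q ∈ P) :
    ∀ᶠ x in 𝓝 q, T (infDist x P) = 0 := by
  filter_upwards [ball_mem_nhds q hs] with x hx
  exact hT0 _ ((infDist_le_dist_of_mem hq).trans (mem_ball.1 hx).le)

lemma eventually_cutoff_eq_one (hT1 : ∀ r, t ≤ r → T r = 1) {x : Euc d} (hx : t < infDist x P) :
    ∀ᶠ y in 𝓝 x, T (infDist y P) = 1 := by
  filter_upwards [(continuous_infDist_pt P).continuousAt.eventually (lt_mem_nhds hx)] with y hy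
  exact hT1 _ hy.le

lemma hasFDerivAt_cutoff (hsep : P.Pairwise fun p q => 2 * r₀ ≤ dist p q)
    (hT : ContDiff ℝ 1 T) {q x : Euc d} (hq : q ∈ P) (hx : dist x q < r₀) (hxq : x ≠ q) :
    HasFDerivAt (fun y => T (infDist y P))
      (deriv T ‖x - q‖ • (‖x - q‖⁻¹ • innerSL ℝ (x - q))) x := by
  have h1 : HasFDerivAt (fun y => ‖y - q‖) (‖x - q‖⁻¹ • innerSL ℝ (x - q)) x := by
    have := (hasFDerivAt_norm_of_ne_zero (sub_ne_zero.2 hxq)).comp x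
      ((hasFDerivAt_id x).sub_const q)
    simpa [Function.comp_def] using this
  have h2 := (hT.differentiable one_ne_zero ‖x - q‖).hasDerivAt.comp_hasFDerivAt x h1
  refine h2.congr_of_eventuallyEq ?_
  filter_upwards [isOpen_ball.mem_nhds (mem_ball.2 hx)] with y hy
  rw [infDist_eq_dist_of_dist_lt hsep hq (mem_ball.1 hy), dist_eq_norm]
  rfl

lemma contDiff_cutoff (hP : P.Nonempty) (hsep : P.Pairwise fun p q => 2 * r₀ ≤ dist p q)
    (hs : 0 < s) (ht : t < r₀) (hT : ContDiff ℝ 1 T)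
    (hT0 : ∀ r ≤ s, T r = 0) (hT1 : ∀ r, t ≤ r → T r = 1) :
    ContDiff ℝ 1 fun x => T (infDist x P) := by
  rw [contDiff_iff_contDiffAt]
  intro x
  rcases lt_or_ge (infDist x P) r₀ with h | h
  · obtain ⟨q, hq, hxq⟩ := exists_dist_lt_of_infDist_lt hP h
    rcases eq_or_ne x q with rfl | hne
    · exact contDiffAt_const.congr_of_eventuallyEq (eventually_cutoff_eq_zero hs hT0 hq)
    · have h1 : ContDiffAt ℝ 1 (fun y => T ‖y - q‖) x :=
        hT.contDiffAt.comp x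
          ((contDiffAt_norm ℝ (sub_ne_zero.2 hne)).comp x (contDiffAt_id.sub contDiffAt_const))
      refine h1.congr_of_eventuallyEq ?_
      filter_upwards [isOpen_ball.mem_nhds (mem_ball.2 hxq)] with y hy
      rw [infDist_eq_dist_of_dist_lt hsep hq (mem_ball.1 hy), dist_eq_norm]
  · exact contDiffAt_const.congr_of_eventuallyEq (eventually_cutoff_eq_one hT1 (ht.trans_le h))

lemma fderiv_cutoff_eq_zero (hT1 : ∀ r, t ≤ r → T r = 1) {x : Euc d} (hx : t < infDist x P) :
    fderiv ℝ (fun y => T (infDist y P)) x = 0 := by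
  have h1 : (fun y => T (infDist y P)) =ᶠ[𝓝 x] fun _ => 1 := eventually_cutoff_eq_one hT1 hx
  rw [h1.fderiv_eq]
  simp

end Cutoff

section Green

variable {d : ℕ} {L : AddSubgroup (Euc d)} {D P : Set (Euc d)}

lemma continuous_mul_of_eventually_eq_zero (hPc : IsClosed P) {u f : Euc d → ℝ}
    (hu : Continuous u) (hu0 : ∀ q ∈ P, ∀ᶠ x in 𝓝 q, u x = 0) (hf : ContinuousOn f Pᶜ) :
    Continuous fun x => u x * f x := by
  rw [continuous_iff_continuousAt]
  intro x
  by_cases hx : x ∈ P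
  · refine (continuousAt_const (y := (0 : ℝ))).congr ?_
    filter_upwards [hu0 x hx] with y hy
    rw [hy, zero_mul]
  · exact hu.continuousAt.mul (hf.continuousAt (hPc.isOpen_compl.mem_nhds hx))

lemma contDiff_mul_of_eventually_eq_zero {u f : Euc d → ℝ}
    (hu : ContDiff ℝ 1 u) (hu0 : ∀ q ∈ P, ∀ᶠ x in 𝓝 q, u x = 0)
    (hf : ∀ x ∉ P, ContDiffAt ℝ 1 f x) :
    ContDiff ℝ 1 fun x => u x * f x := by
  rw [contDiff_iff_contDiffAt]
  intro x
  by_cases hx : x ∈ P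
  · refine (contDiffAt_const (c := (0 : ℝ))).congr_of_eventuallyEq ?_
    filter_upwards [hu0 x hx] with y hy
    rw [hy, zero_mul]
  · exact hu.contDiffAt.mul (hf x hx)

lemma norm_gradient_sq (h : Euc d → ℝ) (x : Euc d) :
    ‖gradient h x‖ ^ 2 = ∑ k, (fderiv ℝ h x (EuclideanSpace.single k 1)) ^ 2 := by
  rw [EuclideanSpace.norm_sq_eq]
  refine Finset.sum_congr rfl fun k _ => ?_
  have : inner ℝ (gradient h x) (EuclideanSpace.single k (1 : ℝ))
      = fderiv ℝ h x (EuclideanSpace.single k 1) := by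
    simp [gradient]
  rw [← this, EuclideanSpace.inner_single_right]
  simp

lemma fderiv_add_of_periodic {f : Euc d → ℝ} (hf : ∀ x, ∀ p ∈ L, f (x + p) = f x)
    (x : Euc d) {p : Euc d} (hp : p ∈ L) : fderiv ℝ f (x + p) = fderiv ℝ f x := by
  rw [← fderiv_comp_add_right p]
  congr 1
  ext y
  exact hf y p hp

theorem green_identity [Countable L] (hD : IsAddFundamentalDomain L D volume)
    (hDb : Bornology.IsBounded D) (hPc : IsClosed P)
    {u h : Euc d → ℝ} (hu : ContDiff ℝ 1 u) (hu0 : ∀ q ∈ P, ∀ᶠ x in 𝓝 q, u x = 0)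
    (huper : ∀ x, ∀ p ∈ L, u (x + p) = u x)
    (hh : ContDiffOn ℝ 2 h Pᶜ) (hhper : ∀ x, ∀ p ∈ L, h (x + p) = h x) {κ : ℝ}
    (hlap : ∀ x ∉ P, ∑ k : Fin d, fderiv ℝ (fun z => fderiv ℝ h z (EuclideanSpace.single k (1:ℝ))) x
        (EuclideanSpace.single k (1:ℝ)) = κ) :
    Continuous (fun x => u x * ‖gradient h x‖ ^ 2) ∧
    Continuous (fun x => ∑ k : Fin d, fderiv ℝ u x (EuclideanSpace.single k 1) *
      (h x * fderiv ℝ h x (EuclideanSpace.single k 1))) ∧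
    Continuous (fun x => u x * h x) ∧
    ∫ x in D, u x * ‖gradient h x‖ ^ 2 =
      - (∫ x in D, ∑ k : Fin d, fderiv ℝ u x (EuclideanSpace.single k 1) *
          (h x * fderiv ℝ h x (EuclideanSpace.single k 1))) - κ * ∫ x in D, u x * h x := by
  obtain ⟨R, hR⟩ := hDb.subset_closedBall 0
  have hint : ∀ {g : Euc d → ℝ}, Continuous g → IntegrableOn g D := fun hg =>
    (hg.continuousOn.integrableOn_compact (isCompact_closedBall 0 R)).mono_set hR
  have hnear : ∀ x ∉ P, Pᶜ ∈ 𝓝 x := fun x hx => hPc.isOpen_compl.mem_nhds hx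
  have hhAt : ∀ x ∉ P, ContDiffAt ℝ 2 h x := fun x hx => hh.contDiffAt (hnear x hx)
  have hdh : ∀ x ∉ P, ContDiffAt ℝ 1 (fderiv ℝ h) x := fun x hx =>
    (hhAt x hx).fderiv_right (by norm_num)
  have hdhk : ∀ (k : Fin d), ∀ x ∉ P,
      ContDiffAt ℝ 1 (fun z => fderiv ℝ h z (EuclideanSpace.single k (1:ℝ))) x := fun k x hx =>
    (hdh x hx).clm_apply contDiffAt_const
  have hprod : ∀ (k : Fin d), ∀ x ∉ P,
      ContDiffAt ℝ 1 (fun z => h z * fderiv ℝ h z (EuclideanSpace.single k (1:ℝ))) x :=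
    fun k x hx => ((hhAt x hx).of_le (by norm_num)).mul (hdhk k x hx)
  have hX : ∀ k : Fin d, ContDiff ℝ 1
      (fun x => u x * (h x * fderiv ℝ h x (EuclideanSpace.single k (1:ℝ)))) := fun k =>
    contDiff_mul_of_eventually_eq_zero hu hu0 (hprod k)
  have hc1 : Continuous (fun x => u x * ‖gradient h x‖ ^ 2) := by
    refine continuous_mul_of_eventually_eq_zero hPc hu.continuous hu0 ?_
    simp only [norm_gradient_sq]
    exact fun x hx => (tendsto_finsetSum _ fun k _ =>
      ((hdhk k x hx).continuousAt.pow 2)).mono_left nhdsWithin_le_nhds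
  have hdu0 : ∀ q ∈ P, ∀ᶠ x in 𝓝 q, fderiv ℝ u x = 0 := by
    intro q hq
    filter_upwards [(hu0 q hq).eventually_nhds] with x hx
    have h1 : u =ᶠ[𝓝 x] fun _ => 0 := hx
    rw [h1.fderiv_eq]
    simp
  have hc2 : Continuous (fun x => ∑ k : Fin d, fderiv ℝ u x (EuclideanSpace.single k 1) *
      (h x * fderiv ℝ h x (EuclideanSpace.single k 1))) := by
    refine continuous_finsetSum _ fun k _ => ?_
    refine continuous_mul_of_eventually_eq_zero hPc
      ((hu.continuous_fderiv one_ne_zero).clm_apply continuous_const) ?_ ?_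
    · intro q hq
      filter_upwards [hdu0 q hq] with x hx
      rw [hx]; rfl
    · exact fun x hx => (hprod k x hx).continuousAt.continuousWithinAt
  have hc3 : Continuous (fun x => u x * h x) :=
    continuous_mul_of_eventually_eq_zero hPc hu.continuous hu0 hh.continuousOn
  refine ⟨hc1, hc2, hc3, ?_⟩
  have hpt : ∀ x, ∑ k : Fin d, fderiv ℝ
      (fun x => u x * (h x * fderiv ℝ h x (EuclideanSpace.single k (1:ℝ)))) x
        (EuclideanSpace.single k (1:ℝ)) =
      (∑ k : Fin d, fderiv ℝ u x (EuclideanSpace.single k 1) *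
        (h x * fderiv ℝ h x (EuclideanSpace.single k 1))) + u x * ‖gradient h x‖ ^ 2
        + κ * (u x * h x) := by
    intro x
    by_cases hx : x ∈ P
    · rw [(hdu0 x hx).self_of_nhds, (hu0 x hx).self_of_nhds]
      have hz : ∀ k : Fin d, fderiv ℝ
          (fun x => u x * (h x * fderiv ℝ h x (EuclideanSpace.single k (1:ℝ)))) x = 0 := by
        intro k
        have h1 : (fun x => u x * (h x * fderiv ℝ h x (EuclideanSpace.single k (1:ℝ))))
            =ᶠ[𝓝 x] fun _ => 0 := by
          filter_upwards [hu0 x hx] with y hy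
          rw [hy, zero_mul]
        rw [h1.fderiv_eq]
        simp
      simp [hz]
    · rw [norm_gradient_sq, ← hlap x hx, Finset.mul_sum, Finset.sum_mul, ← Finset.sum_add_distrib,
        ← Finset.sum_add_distrib]
      refine Finset.sum_congr rfl fun k _ => ?_
      have d1 := (hu.differentiable one_ne_zero x).hasFDerivAt
      have d2 := ((hhAt x hx).differentiableAt two_ne_zero).hasFDerivAt
      have d3 := ((hdhk k x hx).differentiableAt one_ne_zero).hasFDerivAt
      rw [(d1.fun_mul (d2.fun_mul d3)).fderiv]
      simp
      ring
  have hz : ∫ x in D, ∑ k : Fin d, fderiv ℝ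
      (fun x => u x * (h x * fderiv ℝ h x (EuclideanSpace.single k (1:ℝ)))) x
        (EuclideanSpace.single k (1:ℝ)) = 0 := by
    rw [integral_finsetSum _ fun k _ => hint
      (((hX k).continuous_fderiv one_ne_zero).clm_apply continuous_const)]
    refine Finset.sum_eq_zero fun k _ =>
      setIntegral_fderiv_eq_zero_of_periodic hD hDb ?_ (hX k) _
    intro x p hp
    rw [huper x p hp, hhper x p hp, fderiv_add_of_periodic hhper x hp]
  simp only [hpt] at hz
  rw [integral_add (hint (hc2.fun_add hc1)) ((hint hc3).const_mul κ),
    integral_add (hint hc2) (hint hc1), integral_const_mul] at hz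
  linarith

end Green

section Energy

variable {d N : ℕ} {L : AddSubgroup (Euc d)} {D : Set (Euc d)} {a : Fin N → Euc d} {r₀ : ℝ}

/-- The union of the translates by `L` of the points `a i`. -/
def poles (L : AddSubgroup (Euc d)) (a : Fin N → Euc d) : Set (Euc d) := {x | ∃ i, x - a i ∈ L}

lemma self_mem_poles (i : Fin N) : a i ∈ poles L a := ⟨i, by simp⟩

lemma add_mem_poles {x p : Euc d} (hx : x ∈ poles L a) (hp : p ∈ L) : x + p ∈ poles L a := by
  obtain ⟨i, hi⟩ := hx
  exact ⟨i, by rw [add_sub_right_comm]; exact add_mem hi hp⟩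

lemma infDist_poles_add (hP : (poles L a).Nonempty) (x : Euc d) {p : Euc d} (hp : p ∈ L) :
    infDist (x + p) (poles L a) = infDist x (poles L a) := by
  have key : ∀ y : Euc d, ∀ p' ∈ L, infDist (y + p') (poles L a) ≤ infDist y (poles L a) := by
    intro y p' hp'
    refine (le_infDist hP).2 fun q hq => ?_
    refine (infDist_le_dist_of_mem (add_mem_poles hq hp')).trans_eq ?_
    exact dist_add_right _ _ _
  refine le_antisymm (key x p hp) ?_
  simpa using key (x + p) (-p) (neg_mem hp)

lemma countable_poles [Countable L] : (poles L a).Countable := by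
  have : poles L a ⊆ ⋃ i, Set.range fun p : L => a i + p := by
    rintro x ⟨i, hi⟩
    exact Set.mem_iUnion.2 ⟨i, ⟨x - a i, hi⟩, by simp⟩
  exact (Set.countable_iUnion fun i => Set.countable_range _).mono this

lemma eq_zero_of_mem_balls (hsep : (poles L a).Pairwise fun p q => 2 * r₀ ≤ dist p q)
    (hdist : ∀ i j, i ≠ j → a i - a j ∉ L) {i j : Fin N} {x p : Euc d} (hp : p ∈ L)
    (hx : x ∈ ball (a i) r₀) (hxp : x + p ∈ ball (a j) r₀) : i = j ∧ p = 0 := by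
  have h1 : dist (a i + p) (a j) < 2 * r₀ := by
    have h2 := dist_triangle_left (a i + p) (a j) (x + p)
    rw [dist_add_right] at h2
    rw [mem_ball] at hx hxp
    linarith
  have h3 : a i + p = a j := by
    by_contra hne
    exact absurd (hsep (add_mem_poles (self_mem_poles i) hp) (self_mem_poles j) hne)
      (not_le.2 h1)
  have hij : i = j := by
    by_contra hne
    refine hdist i j hne ?_
    rw [← h3, sub_add_cancel_left]
    exact neg_mem hp
  subst hij
  exact ⟨rfl, by simpa using h3⟩

lemma deriv_ramp_eq_zero {s t : ℝ} {T : ℝ → ℝ} (hT0 : ∀ r ≤ s, T r = 0)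
    (hT1 : ∀ r, t ≤ r → T r = 1) {r : ℝ} (hr : r ∉ Set.Icc s t) : deriv T r = 0 := by
  rcases lt_or_ge r s with h | h
  · have : T =ᶠ[𝓝 r] fun _ => 0 := by
      filter_upwards [gt_mem_nhds h] with y hy using hT0 y hy.le
    rw [this.deriv_eq]; simp
  · have h2 : t < r := not_le.1 fun h' => hr ⟨h, h'⟩
    have : T =ᶠ[𝓝 r] fun _ => 1 := by
      filter_upwards [lt_mem_nhds h2] with y hy using hT1 y hy.le
    rw [this.deriv_eq]; simp

lemma continuous_deriv_ramp_mul_ckSlope {s t : ℝ} (hs : 0 < s) {T : ℝ → ℝ}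
    (hT : ContDiff ℝ 1 T) (hT0 : ∀ r ≤ s, T r = 0) (hT1 : ∀ r, t ≤ r → T r = 1) :
    Continuous fun x : Euc d => deriv T ‖x‖ * ckSlope d ‖x‖ := by
  refine continuous_mul_of_eventually_eq_zero (P := {0}) isClosed_singleton
    ((hT.continuous_deriv le_rfl).comp continuous_norm) ?_ ?_
  · rintro q rfl
    filter_upwards [ball_mem_nhds 0 hs] with x hx
    refine deriv_ramp_eq_zero hT0 hT1 fun h => ?_
    exact absurd h.1 (not_le.2 (by simpa using hx))
  · intro x hx
    have : ‖x‖ ^ (d - 1) ≠ 0 := pow_ne_zero _ (norm_ne_zero_iff.2 hx)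
    unfold ckSlope
    exact (continuousAt_const.div (continuous_norm.pow (d - 1)).continuousAt
      this).continuousWithinAt

lemma setIntegral_ball_deriv_ramp_mul_ckSlope (hd : 2 ≤ d) {s t : ℝ} (hs : 0 < s) (ht : t < r₀)
    {T : ℝ → ℝ} (hT : ContDiff ℝ 1 T) (hTm : Monotone T) (hT0 : ∀ r ≤ s, T r = 0)
    (hT1 : ∀ r, t ≤ r → T r = 1) (q : Euc d) :
    ∫ x in ball q r₀, deriv T ‖x - q‖ * ckSlope d ‖x - q‖ = cConst d := by
  rw [← integral_deriv_ramp_mul_ckSlope hd hs hT hTm hT0 hT1,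
    ← integral_sub_right_eq_self (fun x : Euc d => deriv T ‖x‖ * ckSlope d ‖x‖) q]
  refine setIntegral_eq_integral_of_forall_compl_eq_zero fun x hx => ?_
  rw [deriv_ramp_eq_zero hT0 hT1, zero_mul]
  intro h
  rw [mem_ball, dist_eq_norm, not_lt] at hx
  linarith [h.2]

lemma exists_tail_le [Countable L] (hd : 2 ≤ d) (hP : (poles L a).Nonempty)
    (hPc : IsClosed (poles L a))
    {h : Euc d → ℝ} (hint : IntegrableOn h D) {ε : ℝ} (hε : 0 < ε) :
    ∃ ρ > 0, ∀ t < ρ, 0 < t →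
      ∫ x in D, {x | infDist x (poles L a) < t}.indicator (fun x => |h x|) x ≤ ε := by
  have := nontrivial_euc hd
  have hm : ∀ t : ℝ, MeasurableSet {x : Euc d | infDist x (poles L a) < t} := fun t =>
    (isOpen_lt (continuous_infDist_pt _) continuous_const).measurableSet
  have key : Tendsto (fun t : ℝ => ∫ x in D,
      {x | infDist x (poles L a) < t}.indicator (fun x => |h x|) x) (𝓝[>] 0)
      (𝓝 (∫ x in D, (fun _ => (0 : ℝ)) x)) := by
    refine tendsto_integral_filter_of_dominated_convergence (fun x => |h x|) ?_ ?_ hint.abs ?_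
    · exact Eventually.of_forall fun t => hint.abs.aestronglyMeasurable.indicator (hm t)
    · refine Eventually.of_forall fun t => Eventually.of_forall fun x => ?_
      refine (norm_indicator_le_norm_self _ _).trans_eq ?_
      simp
    · have hae : ∀ᵐ x ∂(volume.restrict D), x ∉ poles L a :=
        ae_restrict_of_ae (measure_eq_zero_iff_ae_notMem.1 (countable_poles.measure_zero _))
      filter_upwards [hae] with x hx
      have hpos : 0 < infDist x (poles L a) := (hPc.notMem_iff_infDist_pos hP).1 hx
      refine tendsto_const_nhds.congr' ?_
      filter_upwards [Ioo_mem_nhdsGT hpos] with t ht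
      rw [Set.indicator_of_notMem]
      exact not_lt.2 ht.2.le
  rw [integral_zero] at key
  have h2 := key.eventually (ge_mem_nhds hε)
  obtain ⟨ρ, hρ, h3⟩ := mem_nhdsGT_iff_exists_Ioo_subset.1 h2
  exact ⟨ρ, hρ, fun t ht ht0 => h3 ⟨ht0, ht⟩⟩

lemma sum_fderiv_mul (f g : Euc d → ℝ) (x y : Euc d) (c m : ℝ)
    (hf : fderiv ℝ f x = c • (m⁻¹ • innerSL ℝ y)) :
    ∑ k : Fin d, fderiv ℝ f x (EuclideanSpace.single k 1) *
      (g x * fderiv ℝ g x (EuclideanSpace.single k 1)) =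
      c * (g x * fderiv ℝ g x (m⁻¹ • y)) := by
  have hy : y = ∑ k : Fin d, y k • EuclideanSpace.single k (1 : ℝ) := by
    simpa using ((EuclideanSpace.basisFun (Fin d) ℝ).sum_repr y).symm
  conv_rhs => rw [hy]
  rw [map_smul, map_sum, smul_eq_mul, Finset.mul_sum, Finset.mul_sum, Finset.mul_sum, hf]
  refine Finset.sum_congr rfl fun k _ => ?_
  simp [EuclideanSpace.inner_single_right]
  ring

theorem cutoff_energy_bounds [Countable L] (hd : 2 ≤ d) (hN : 1 ≤ N)
    (hD : IsAddFundamentalDomain L D volume) (hDm : MeasurableSet D)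
    (hDb : Bornology.IsBounded D) (hr₀ : 0 < r₀)
    (hsep : (poles L a).Pairwise fun p q => 2 * r₀ ≤ dist p q)
    (hdist : ∀ i j, i ≠ j → a i - a j ∉ L)
    {h : Euc d → ℝ} (hh : ContDiffOn ℝ 2 h (poles L a)ᶜ)
    (hhper : ∀ x, ∀ p ∈ L, h (x + p) = h x) {κ : ℝ}
    (hlap : ∀ x ∉ poles L a,
      ∑ k : Fin d, fderiv ℝ (fun z => fderiv ℝ h z (EuclideanSpace.single k (1:ℝ))) x
        (EuclideanSpace.single k (1:ℝ)) = κ)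
    (hint : IntegrableOn h D) (hmean : ∫ x in D, h x = 0) (g : Fin N → ℝ)
    (hQ : ∀ i, ∀ ε > 0, ∀ᶠ x in 𝓝[≠] (a i),
      |-(h x * fderiv ℝ h x (‖x - a i‖⁻¹ • (x - a i)))
        - (ckr d ‖x - a i‖ + g i) * ckSlope d ‖x - a i‖| ≤ ε * ckSlope d ‖x - a i‖)
    {ε : ℝ} (hε : 0 < ε) :
    ∃ ρ > 0, ∀ s t : ℝ, 0 < s → s < t → t < ρ → ∀ T : ℝ → ℝ, ContDiff ℝ 1 T → Monotone T →
      (∀ r ≤ s, T r = 0) → (∀ r, t ≤ r → T r = 1) →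
      IntegrableOn (fun x => T (infDist x (poles L a)) * ‖gradient h x‖ ^ 2) D ∧
      ∑ i, cConst d * (ckr d t + g i - ε) - |κ| * ε ≤
        ∫ x in D, T (infDist x (poles L a)) * ‖gradient h x‖ ^ 2 ∧
      ∫ x in D, T (infDist x (poles L a)) * ‖gradient h x‖ ^ 2 ≤
        ∑ i, cConst d * (ckr d s + g i + ε) + |κ| * ε := by
  have hP : (poles L a).Nonempty := ⟨a ⟨0, hN⟩, self_mem_poles _⟩
  have hPc : IsClosed (poles L a) := isClosed_of_pairwise_le_dist (by positivity) hsep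
  obtain ⟨R, hR⟩ := hDb.subset_closedBall 0
  have hintD : ∀ {g : Euc d → ℝ}, Continuous g → IntegrableOn g D := fun hg =>
    (hg.continuousOn.integrableOn_compact (isCompact_closedBall 0 R)).mono_set hR
  obtain ⟨ρ₁, hρ₁, htail⟩ := exists_tail_le (D := D) hd hP hPc hint hε
  obtain ⟨ρ₂, hρ₂, hQ'⟩ : ∃ ρ₂ > 0, ∀ i, ∀ x, x ≠ a i → dist x (a i) < ρ₂ →
      |-(h x * fderiv ℝ h x (‖x - a i‖⁻¹ • (x - a i)))
        - (ckr d ‖x - a i‖ + g i) * ckSlope d ‖x - a i‖| ≤ ε * ckSlope d ‖x - a i‖ := by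
    have h1 : ∀ i, ∃ ρ > 0, ∀ x, x ≠ a i → dist x (a i) < ρ →
        |-(h x * fderiv ℝ h x (‖x - a i‖⁻¹ • (x - a i)))
          - (ckr d ‖x - a i‖ + g i) * ckSlope d ‖x - a i‖| ≤ ε * ckSlope d ‖x - a i‖ := by
      intro i
      obtain ⟨ρ, hρ, h2⟩ := Metric.eventually_nhds_iff.1
        (eventually_nhdsWithin_iff.1 (hQ i ε hε))
      exact ⟨ρ, hρ, fun x hx hxd => h2 hxd hx⟩
    choose ρ hρ h2 using h1
    have hne : (Finset.univ : Finset (Fin N)).Nonempty := ⟨⟨0, hN⟩, Finset.mem_univ _⟩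
    refine ⟨Finset.univ.inf' hne ρ, (Finset.lt_inf'_iff hne).2 fun i _ => hρ i, ?_⟩
    intro i x hx hxd
    exact h2 i x hx (hxd.trans_le (Finset.inf'_le _ (Finset.mem_univ i)))
  refine ⟨min r₀ (min ρ₁ ρ₂), by positivity, ?_⟩
  intro s t hs hst ht T hT hTm hT0 hT1
  have ht0 : t < r₀ := ht.trans_le (min_le_left _ _)
  have ht1 : t < ρ₁ := ht.trans_le ((min_le_right _ _).trans (min_le_left _ _))
  have ht2 : t < ρ₂ := ht.trans_le ((min_le_right _ _).trans (min_le_right _ _))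
  have htpos : 0 < t := hs.trans hst
  have hTnn : ∀ r, 0 ≤ T r := fun r => by
    have := hTm (min_le_left r s)
    rwa [hT0 _ (min_le_right r s)] at this
  have hTle : ∀ r, T r ≤ 1 := fun r => by
    have := hTm (le_max_left r t)
    rwa [hT1 _ (le_max_right r t)] at this
  obtain ⟨hc1, hc2, hc3, hgreen⟩ := green_identity hD hDb hPc
    (contDiff_cutoff hP hsep hs ht0 hT hT0 hT1)
    (fun q hq => eventually_cutoff_eq_zero hs hT0 hq)
    (fun x p hp => by rw [infDist_poles_add hP x hp]) hh hhper hlap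
  refine ⟨hintD hc1, ?_⟩
  have hlow : |κ * ∫ x in D, T (infDist x (poles L a)) * h x| ≤ |κ| * ε := by
    rw [abs_mul]
    refine mul_le_mul_of_nonneg_left ?_ (abs_nonneg _)
    have e : ∫ x in D, T (infDist x (poles L a)) * h x
        = ∫ x in D, (T (infDist x (poles L a)) * h x - h x) := by
      rw [integral_sub (hintD hc3) hint, hmean, sub_zero]
    rw [e]
    refine abs_integral_le_integral_abs.trans ((integral_mono ?_ ?_ ?_).trans (htail t ht1 htpos))
    · exact ((hintD hc3).sub hint).abs
    · exact hint.abs.indicator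
        (isOpen_lt (continuous_infDist_pt _) continuous_const).measurableSet
    · intro x
      by_cases hx : infDist x (poles L a) < t
      · rw [Set.indicator_of_mem (by exact hx)]
        have : T (infDist x (poles L a)) * h x - h x
            = -((1 - T (infDist x (poles L a))) * h x) := by ring
        simp only [this, abs_neg, abs_mul]
        rw [abs_of_nonneg (sub_nonneg.2 (hTle _))]
        exact mul_le_of_le_one_left (abs_nonneg _) (by linarith [hTnn (infDist x (poles L a))])
      · rw [Set.indicator_of_notMem (by exact hx)]
        simp [hT1 _ (not_lt.1 hx)]
  set f : Euc d → ℝ := fun x => ∑ k : Fin d,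
    fderiv ℝ (fun y => T (infDist y (poles L a))) x (EuclideanSpace.single k 1) *
      (h x * fderiv ℝ h x (EuclideanSpace.single k 1)) with hf
  have hf0 : ∀ x, t < infDist x (poles L a) → f x = 0 := by
    intro x hx
    simp only [hf]
    rw [fderiv_cutoff_eq_zero hT1 hx]
    simp
  have hfper : ∀ x, ∀ p ∈ L, f (x + p) = f x := by
    intro x p hp
    simp only [hf]
    rw [fderiv_add_of_periodic (fun y p' hp' => by rw [infDist_poles_add hP y hp']) x hp,
      fderiv_add_of_periodic hhper x hp, hhper x p hp]
  have hunfold : ∫ x in D, f x = ∑ i, ∫ x in ball (a i) r₀, f x := by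
    have hfball : ∀ i, IntegrableOn f (ball (a i) r₀) := fun i =>
      (hc2.continuousOn.integrableOn_compact (isCompact_closedBall _ r₀)).mono_set
        ball_subset_closedBall
    rw [setIntegral_eq_of_periodic_of_support hD hDm hfper
      (S := ⋃ i, ball (a i) r₀) (MeasurableSet.iUnion fun i => measurableSet_ball) ?_ ?_ ?_
      (hintD hc2), integral_iUnion (fun i => measurableSet_ball) ?_ ?_, tsum_fintype]
    · intro i j hij
      rw [Function.onFun, Set.disjoint_left]
      intro x hx hx'
      exact hij (eq_zero_of_mem_balls hsep hdist (zero_mem L) hx (by simpa using hx')).1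
    · exact integrableOn_finite_iUnion.2 hfball
    · intro x hx p hp hxp
      obtain ⟨i, hi⟩ := Set.mem_iUnion.1 hx
      obtain ⟨j, hj⟩ := Set.mem_iUnion.1 hxp
      exact (eq_zero_of_mem_balls hsep hdist hp hi hj).2
    · intro x hx
      have hx' : infDist x (poles L a) < r₀ := by
        by_contra hcon
        exact hx (hf0 x (ht0.trans_le (not_lt.1 hcon)))
      obtain ⟨q, ⟨i, hi⟩, hxq⟩ := exists_dist_lt_of_infDist_lt hP hx'
      refine ⟨-(q - a i), neg_mem hi, Set.mem_iUnion.2 ⟨i, ?_⟩⟩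
      rw [mem_ball, dist_eq_norm]
      rw [dist_eq_norm] at hxq
      convert hxq using 2
      abel
    · exact integrableOn_finite_iUnion.2 hfball
  have hpt : ∀ i, ∀ x ∈ ball (a i) r₀,
      deriv T ‖x - a i‖ * ckSlope d ‖x - a i‖ * (ckr d t + g i - ε) ≤ -f x ∧
      -f x ≤ deriv T ‖x - a i‖ * ckSlope d ‖x - a i‖ * (ckr d s + g i + ε) := by
    intro i x hx
    rcases eq_or_ne x (a i) with rfl | hne
    · have h1 : f (a i) = 0 := by
        have h2 : (fun y => T (infDist y (poles L a))) =ᶠ[𝓝 (a i)] fun _ => 0 :=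
          eventually_cutoff_eq_zero hs hT0 (self_mem_poles i)
        simp only [hf]
        rw [h2.fderiv_eq]
        simp
      have h3 : deriv T 0 = 0 :=
        deriv_ramp_eq_zero hT0 hT1 fun h => absurd h.1 (not_le.2 hs)
      simp [h1, h3]
    · have hrpos : 0 < ‖x - a i‖ := norm_pos_iff.2 (sub_ne_zero.2 hne)
      have h1 : f x = deriv T ‖x - a i‖ * (h x * fderiv ℝ h x (‖x - a i‖⁻¹ • (x - a i))) :=
        sum_fderiv_mul _ _ _ _ _ _
          (hasFDerivAt_cutoff hsep hT (self_mem_poles i) (mem_ball.1 hx) hne).fderiv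
      by_cases hr : ‖x - a i‖ ∈ Set.Icc s t
      · have h2 := abs_le.1 (hQ' i x hne (by rw [dist_eq_norm]; exact hr.2.trans_lt ht2))
        have hW := ckSlope_pos hd hrpos
        have m1 := ckr_antitoneOn hd (Set.mem_Ioi.2 hs) (Set.mem_Ioi.2 hrpos) hr.1
        have m2 := ckr_antitoneOn hd (Set.mem_Ioi.2 hrpos) (Set.mem_Ioi.2 htpos) hr.2
        have hTd : 0 ≤ deriv T ‖x - a i‖ := hTm.deriv_nonneg
        rw [h1, mul_assoc, mul_assoc, ← mul_neg]
        constructor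
        · refine mul_le_mul_of_nonneg_left ?_ hTd
          have := mul_le_mul_of_nonneg_left m2 hW.le
          nlinarith [h2.1]
        · refine mul_le_mul_of_nonneg_left ?_ hTd
          have := mul_le_mul_of_nonneg_left m1 hW.le
          nlinarith [h2.2]
      · have h3 := deriv_ramp_eq_zero hT0 hT1 hr
        simp [h1, h3]
  have hballint : ∀ i (c : ℝ), IntegrableOn
      (fun x => deriv T ‖x - a i‖ * ckSlope d ‖x - a i‖ * c) (ball (a i) r₀) := by
    intro i c
    have h1 : Continuous fun x : Euc d => deriv T ‖x - a i‖ * ckSlope d ‖x - a i‖ :=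
      (continuous_deriv_ramp_mul_ckSlope hs hT hT0 hT1).comp
        (continuous_id.sub continuous_const)
    exact ((h1.mul_const c).continuousOn.integrableOn_compact
      (isCompact_closedBall _ r₀)).mono_set ball_subset_closedBall
  have hfint : ∀ i, IntegrableOn (fun x => -f x) (ball (a i) r₀) := fun i =>
    (hc2.neg.continuousOn.integrableOn_compact (isCompact_closedBall _ r₀)).mono_set
      ball_subset_closedBall
  have hB : ∀ i, cConst d * (ckr d t + g i - ε) ≤ ∫ x in ball (a i) r₀, -f x ∧
      ∫ x in ball (a i) r₀, -f x ≤ cConst d * (ckr d s + g i + ε) := by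
    intro i
    rw [← setIntegral_ball_deriv_ramp_mul_ckSlope hd hs ht0 hT hTm hT0 hT1 (a i),
      ← integral_mul_const, ← integral_mul_const]
    exact ⟨setIntegral_mono_on (hballint i _) (hfint i) measurableSet_ball
        fun x hx => (hpt i x hx).1,
      setIntegral_mono_on (hfint i) (hballint i _) measurableSet_ball
        fun x hx => (hpt i x hx).2⟩
  rw [hgreen, hunfold, ← Finset.sum_neg_distrib]
  simp only [← integral_neg]
  have s1 := Finset.sum_le_sum fun i (_ : i ∈ Finset.univ) => (hB i).1
  have s2 := Finset.sum_le_sum fun i (_ : i ∈ Finset.univ) => (hB i).2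
  have := abs_le.1 hlow
  constructor <;> linarith [this.1, this.2]

end Energy

section Limit

variable {d N : ℕ} {L : AddSubgroup (Euc d)} {D : Set (Euc d)} {a : Fin N → Euc d} {r₀ : ℝ}

theorem tendsto_energy_sub [Countable L] (hd : 2 ≤ d) (hN : 1 ≤ N)
    (hD : IsAddFundamentalDomain L D volume) (hDm : MeasurableSet D)
    (hDb : Bornology.IsBounded D) (hr₀ : 0 < r₀)
    (hsep : (poles L a).Pairwise fun p q => 2 * r₀ ≤ dist p q)
    (hdist : ∀ i j, i ≠ j → a i - a j ∉ L)
    {h : Euc d → ℝ} (hh : ContDiffOn ℝ 2 h (poles L a)ᶜ)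
    (hhper : ∀ x, ∀ p ∈ L, h (x + p) = h x) {κ : ℝ}
    (hlap : ∀ x ∉ poles L a,
      ∑ k : Fin d, fderiv ℝ (fun z => fderiv ℝ h z (EuclideanSpace.single k (1:ℝ))) x
        (EuclideanSpace.single k (1:ℝ)) = κ)
    (hint : IntegrableOn h D) (hmean : ∫ x in D, h x = 0) (g : Fin N → ℝ)
    (hQ : ∀ i, ∀ ε > 0, ∀ᶠ x in 𝓝[≠] (a i),
      |-(h x * fderiv ℝ h x (‖x - a i‖⁻¹ • (x - a i)))
        - (ckr d ‖x - a i‖ + g i) * ckSlope d ‖x - a i‖| ≤ ε * ckSlope d ‖x - a i‖) :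
    Tendsto (fun η : ℝ =>
      (∫ x in D \ {x | infDist x (poles L a) < η}, ‖gradient h x‖ ^ 2)
        - (N : ℝ) * cConst d * ckr d η) (𝓝[>] 0) (𝓝 (cConst d * ∑ i, g i)) := by
  rw [Metric.tendsto_nhds]
  intro ε' hε'
  have hc := cConst_pos hd
  set K : ℝ := 2 * N * cConst d + |κ| + 1 with hK
  have hKpos : 0 < K := by positivity
  set ε := ε' / (2 * K) with hεdef
  have hε : 0 < ε := by positivity
  have hKε : K * ε = ε' / 2 := by rw [hεdef]; field_simp
  obtain ⟨ρ, hρ, hbd⟩ := cutoff_energy_bounds hd hN hD hDm hDb hr₀ hsep hdist hh hhper hlap hint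
    hmean g hQ hε
  filter_upwards [Ioo_mem_nhdsGT hρ] with η hη
  have hηpos : 0 < η := hη.1
  have hUm : MeasurableSet {x : Euc d | infDist x (poles L a) < η} :=
    (isOpen_lt (continuous_infDist_pt _) continuous_const).measurableSet
  have hcont : ContinuousAt (ckr d) η := (hasDerivAt_ckr hd hηpos).continuousAt
  obtain ⟨τ, hτ, hτb⟩ := Metric.continuousAt_iff.1 hcont ε hε
  obtain ⟨s, hs1, hs2⟩ := exists_between (max_lt hηpos (by linarith : η - τ < η))
  obtain ⟨t, ht1, ht2⟩ := exists_between (lt_min hη.2 (by linarith : η < η + τ))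
  have hs0 : 0 < s := (le_max_left _ _).trans_lt hs1
  have hsτ : η - τ < s := (le_max_right _ _).trans_lt hs1
  have htρ : t < ρ := ht2.trans_le (min_le_left _ _)
  have htτ : t < η + τ := ht2.trans_le (min_le_right _ _)
  have hws := hτb (show dist s η < τ by rw [Real.dist_eq, abs_lt]; constructor <;> linarith)
  have hwt := hτb (show dist t η < τ by rw [Real.dist_eq, abs_lt]; constructor <;> linarith)
  rw [Real.dist_eq, abs_lt] at hws hwt
  obtain ⟨T, hT, hTm, hT0, hT1⟩ := exists_ramp hs2
  obtain ⟨hi1, -, hF1⟩ := hbd s η hs0 hs2 hη.2 T hT hTm hT0 hT1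
  obtain ⟨T', hT', hTm', hT0', hT1'⟩ := exists_ramp ht1
  obtain ⟨hi2, hF2, -⟩ := hbd η t hηpos ht1 htρ T' hT' hTm' hT0' hT1'
  have hTnn : ∀ r, 0 ≤ T r := fun r => by
    have := hTm (min_le_left r s)
    rwa [hT0 _ (min_le_right r s)] at this
  have hTle' : ∀ r, T' r ≤ 1 := fun r => by
    have := hTm' (le_max_left r t)
    rwa [hT1' _ (le_max_right r t)] at this
  have hiE : IntegrableOn (fun x => ‖gradient h x‖ ^ 2)
      (D \ {x | infDist x (poles L a) < η}) := by
    refine (hi1.mono_set Set.sdiff_subset).congr_fun ?_ (hDm.diff hUm)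
    intro x hx
    simp [hT1 _ (not_lt.1 hx.2)]
  have hle : ∫ x in D \ {x | infDist x (poles L a) < η}, ‖gradient h x‖ ^ 2
      ≤ ∫ x in D, T (infDist x (poles L a)) * ‖gradient h x‖ ^ 2 := by
    rw [setIntegral_congr_fun (g := fun x => T (infDist x (poles L a)) * ‖gradient h x‖ ^ 2)
      (hDm.diff hUm) fun x hx => by simp [hT1 _ (not_lt.1 hx.2)]]
    refine setIntegral_mono_set hi1 (Eventually.of_forall fun x => ?_)
      (Set.sdiff_subset.eventuallyLE)
    exact mul_nonneg (hTnn _) (by positivity)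
  have hge : ∫ x in D, T' (infDist x (poles L a)) * ‖gradient h x‖ ^ 2
      ≤ ∫ x in D \ {x | infDist x (poles L a) < η}, ‖gradient h x‖ ^ 2 := by
    rw [setIntegral_eq_of_subset_of_forall_sdiff_eq_zero hDm
      (Set.sdiff_subset (t := {x | infDist x (poles L a) < η})) ?_]
    · refine setIntegral_mono (hi2.mono_set Set.sdiff_subset) hiE fun x => ?_
      exact mul_le_of_le_one_left (by positivity) (hTle' _)
    · intro x hx
      have hx' : infDist x (poles L a) < η := by
        by_contra hcon
        exact hx.2 ⟨hx.1, hcon⟩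
      rw [hT0' _ hx'.le, zero_mul]
  have e : ∀ w : ℝ, ∑ i, cConst d * (w + g i)
      = N * cConst d * w + cConst d * ∑ i, g i := by
    intro w
    rw [← Finset.mul_sum, Finset.sum_add_distrib]
    simp
    ring
  have e1 := e (ckr d s + ε)
  have e2 := e (ckr d t - ε)
  have e1' : ∑ i, cConst d * (ckr d s + g i + ε) = ∑ i, cConst d * (ckr d s + ε + g i) :=
    Finset.sum_congr rfl fun i _ => by ring
  have e2' : ∑ i, cConst d * (ckr d t + g i - ε) = ∑ i, cConst d * (ckr d t - ε + g i) :=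
    Finset.sum_congr rfl fun i _ => by ring
  rw [e1', e1] at hF1
  rw [e2', e2] at hF2
  have hNc : (0 : ℝ) ≤ N * cConst d := by positivity
  have b1 := mul_le_mul_of_nonneg_left (show ckr d s + ε ≤ ckr d η + 2 * ε by linarith) hNc
  have b2 := mul_le_mul_of_nonneg_left (show ckr d η - 2 * ε ≤ ckr d t - ε by linarith) hNc
  have hexp : K * ε = 2 * (N * cConst d * ε) + |κ| * ε + ε := by rw [hK]; ring
  rw [Real.dist_eq, abs_lt]
  constructor <;> nlinarith

end Limit

section Pole

variable {d : ℕ}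

lemma tendsto_norm_sub_nhdsGT (q : Euc d) :
    Tendsto (fun x => ‖x - q‖) (𝓝[≠] q) (𝓝[>] 0) := by
  refine tendsto_nhdsWithin_iff.2 ⟨?_, ?_⟩
  · have : ContinuousAt (fun x => ‖x - q‖) q := by fun_prop
    simpa using this.tendsto.mono_left nhdsWithin_le_nhds
  · filter_upwards [self_mem_nhdsWithin] with x hx
    exact norm_pos_iff.2 (sub_ne_zero.2 hx)

lemma eventually_flux_density_near_pole (hd : 2 ≤ d) {h φ : Euc d → ℝ} {q : Euc d}
    (hφ : ContDiffAt ℝ 1 φ q) (hh : ∀ᶠ x in 𝓝[≠] q, h x = ck d (x - q) + φ x)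
    {ε : ℝ} (hε : 0 < ε) :
    ∀ᶠ x in 𝓝[≠] q,
      |-(h x * fderiv ℝ h x (‖x - q‖⁻¹ • (x - q)))
        - (ckr d ‖x - q‖ + φ q) * ckSlope d ‖x - q‖| ≤ ε * ckSlope d ‖x - q‖ := by
  set B : ℝ := ‖fderiv ℝ φ q‖ + 1 with hB
  have hBpos : 0 < B := by positivity
  set δ : ℝ := min 1 (ε / 2) with hδ
  have hδpos : 0 < δ := by positivity
  have hw : ∀ᶠ x in 𝓝[≠] q, |ckr d ‖x - q‖ * (ckSlope d ‖x - q‖)⁻¹| < ε / (4 * B) := by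
    have h1 := ((tendsto_ckr_mul_inv_ckSlope hd).comp (tendsto_norm_sub_nhdsGT q)).abs
    rw [abs_zero] at h1
    exact h1.eventually (gt_mem_nhds (by positivity))
  have hW : ∀ᶠ x in 𝓝[≠] q, (ckSlope d ‖x - q‖)⁻¹ < ε / (4 * B * (|φ q| + 1)) :=
    ((tendsto_inv_ckSlope hd).comp (tendsto_norm_sub_nhdsGT q)).eventually
      (gt_mem_nhds (by positivity))
  have hφc : ∀ᶠ x in 𝓝[≠] q, |φ x - φ q| < δ :=
    eventually_nhdsWithin_of_eventually_nhds
      (Metric.tendsto_nhds.1 hφ.continuousAt.tendsto δ hδpos)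
  have hφd : ∀ᶠ x in 𝓝[≠] q, DifferentiableAt ℝ φ x := by
    refine eventually_nhdsWithin_of_eventually_nhds ?_
    filter_upwards [hφ.eventually (by simp)] with x hx
    exact hx.differentiableAt one_ne_zero
  have hφB : ∀ᶠ x in 𝓝[≠] q, ‖fderiv ℝ φ x‖ < B := by
    refine eventually_nhdsWithin_of_eventually_nhds ?_
    exact (hφ.fderiv_right (m := 0) (by norm_num)).continuousAt.norm.eventually
      (gt_mem_nhds (by linarith))
  filter_upwards [hw, hW, hφc, hφd, hφB, eventually_eventually_nhdsWithin.2 hh, hh,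
    self_mem_nhdsWithin] with x hw hW hφc hφd hφB hhn hhx hxq
  have hxq : x ≠ q := hxq
  have hy : x - q ≠ 0 := sub_ne_zero.2 hxq
  have hr : 0 < ‖x - q‖ := norm_pos_iff.2 hy
  have hSl := ckSlope_pos hd hr
  set S := ckSlope d ‖x - q‖ with hS
  have hev : h =ᶠ[𝓝 x] fun z => ckr d ‖z - q‖ + φ z := by
    rw [isOpen_compl_singleton.nhdsWithin_eq hxq] at hhn
    exact hhn
  have hder : fderiv ℝ h x (‖x - q‖⁻¹ • (x - q))
      = -S + fderiv ℝ φ x (‖x - q‖⁻¹ • (x - q)) := by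
    have h1 : HasFDerivAt (fun z => ‖z - q‖) (‖x - q‖⁻¹ • innerSL ℝ (x - q)) x := by
      have := (hasFDerivAt_norm_of_ne_zero hy).comp x ((hasFDerivAt_id x).sub_const q)
      simpa [Function.comp_def] using this
    have h2 := ((hasDerivAt_ckr hd hr).comp_hasFDerivAt x h1).add hφd.hasFDerivAt
    have h3 := h2.congr_of_eventuallyEq hev
    rw [h3.fderiv]
    have h4 : ‖x - q‖⁻¹ * (‖x - q‖⁻¹ * ‖x - q‖ ^ 2) = 1 := by field_simp
    simp only [add_apply, smul_apply, innerSL_apply_apply,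
      smul_eq_mul, inner_smul_right, real_inner_self_eq_norm_sq, h4, mul_one]
    rfl
  have hD : |fderiv ℝ φ x (‖x - q‖⁻¹ • (x - q))| ≤ B := by
    have h1 := (fderiv ℝ φ x).le_opNorm (‖x - q‖⁻¹ • (x - q))
    have h2 : ‖‖x - q‖⁻¹ • (x - q)‖ = 1 := by
      rw [norm_smul, norm_inv, norm_norm, inv_mul_cancel₀ hr.ne']
    rw [h2, mul_one, Real.norm_eq_abs] at h1
    linarith
  rw [hder, hhx, ck_eq_ckr_norm]
  set w := ckr d ‖x - q‖
  set e := fderiv ℝ φ x (‖x - q‖⁻¹ • (x - q))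
  have e1 : -((w + φ x) * (-S + e)) - (w + φ q) * S = (φ x - φ q) * S - (w + φ x) * e := by ring
  have hwS : |w| ≤ ε / (4 * B) * S := by
    rw [abs_mul, abs_inv, abs_of_pos hSl, ← div_eq_mul_inv, div_lt_iff₀ hSl] at hw
    exact hw.le
  have hS1 : (|φ q| + 1) ≤ ε / (4 * B) * S := by
    have h0 : (0 : ℝ) < |φ q| + 1 := by positivity
    rw [inv_lt_comm₀ hSl (by positivity)] at hW
    have : (ε / (4 * B * (|φ q| + 1)))⁻¹ = (|φ q| + 1) / (ε / (4 * B)) := by field_simp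
    rw [this, div_lt_iff₀ (by positivity)] at hW
    linarith
  have hφx : |φ x| ≤ |φ q| + 1 := by
    have h1 := abs_sub_abs_le_abs_sub (φ x) (φ q)
    have h2 : δ ≤ 1 := min_le_left _ _
    linarith
  have h3 : |w + φ x| ≤ ε / (4 * B) * S + ε / (4 * B) * S :=
    (abs_add_le _ _).trans (add_le_add hwS (hφx.trans hS1))
  have h4 : |(w + φ x) * e| ≤ ε / 2 * S := by
    rw [abs_mul]
    refine (mul_le_mul h3 hD (abs_nonneg _) (by positivity)).trans_eq ?_
    field_simp
    ring
  have h5 : |(φ x - φ q) * S| ≤ ε / 2 * S := by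
    rw [abs_mul, abs_of_pos hSl]
    exact mul_le_mul_of_nonneg_right (hφc.le.trans (min_le_right _ _)) hSl.le
  rw [e1]
  have := abs_sub ((φ x - φ q) * S) ((w + φ x) * e)
  linarith

end Pole

section Lattice

variable {d N : ℕ} {L : AddSubgroup (Euc d)} {a : Fin N → Euc d}

lemma exists_basis_of_det_ne_zero {v : Fin d → Euc d}
    (hv : Matrix.det (Matrix.of fun i j : Fin d => v j i) ≠ 0) :
    ∃ b : Module.Basis (Fin d) ℝ (Euc d), ⇑b = v := by
  have h1 : LinearIndependent ℝ v := by
    have h2 := Matrix.linearIndependent_cols_of_det_ne_zero hv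
    have h3 : (Matrix.of fun i j : Fin d => v j i).col
        = (EuclideanSpace.equiv (Fin d) ℝ).toLinearMap ∘ v := by
      ext i j
      rfl
    rw [h3] at h2
    exact h2.of_comp _
  exact ⟨Module.Basis.mk h1 (h1.span_eq_top_of_card_eq_finrank' (by simp)).ge, by simp⟩

lemma lat_eq_span (b : Module.Basis (Fin d) ℝ (Euc d)) :
    lat d b = ((Submodule.span ℤ (Set.range b)).toAddSubgroup : Set (Euc d)) := by
  ext x
  simp [lat, Submodule.mem_span_range_iff_exists_fun, Int.cast_smul_eq_zsmul]

lemma fundDomain_eq (b : Module.Basis (Fin d) ℝ (Euc d)) :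
    fundDomain d b = ZSpan.fundamentalDomain b := by
  ext x
  simp only [fundDomain, Set.mem_image, Set.mem_univ_pi, ZSpan.mem_fundamentalDomain]
  constructor
  · rintro ⟨t, ht, rfl⟩ i
    rw [b.repr_sum_self]
    exact ht i
  · intro h
    exact ⟨b.repr x, h, b.sum_repr x⟩

lemma exists_poles_separated (hfin : ∀ s : Set (Euc d), Bornology.IsBounded s →
    (s ∩ L).Finite) (a : Fin N → Euc d) :
    ∃ r₀ : ℝ, 0 < r₀ ∧ (poles L a).Pairwise fun p q => 2 * r₀ ≤ dist p q := by
  set S : Set (Euc d) := (⋃ ij : Fin N × Fin N,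
    (fun y => y + (a ij.1 - a ij.2)) '' (closedBall (-(a ij.1 - a ij.2)) 1 ∩ L)) \ {0} with hS
  have hSf : S.Finite :=
    (Set.finite_iUnion fun ij => (hfin _ isBounded_closedBall).image _).subset Set.sdiff_subset
  obtain ⟨ε, hε, hεS⟩ := Metric.isOpen_iff.1 hSf.isClosed.isOpen_compl 0 (by simp [hS])
  refine ⟨min 1 ε / 2, by positivity, ?_⟩
  rintro p ⟨i, hi⟩ q ⟨j, hj⟩ hpq
  by_contra hlt
  rw [not_le, mul_div_cancel₀ _ (two_ne_zero), lt_min_iff, dist_eq_norm] at hlt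
  refine hεS (show p - q ∈ ball 0 ε by simpa using hlt.2) ⟨?_, by simpa [sub_eq_zero] using hpq⟩
  refine Set.mem_iUnion.2 ⟨(i, j), p - q - (a i - a j), ⟨?_, ?_⟩, by simp⟩
  · rw [mem_closedBall, dist_eq_norm, sub_neg_eq_add, sub_add_cancel]
    exact hlt.1.le
  · have : p - q - (a i - a j) = (p - a i) - (q - a j) := by abel
    rw [this]
    exact sub_mem hi hj

lemma integrableOn_comp_sub {f : Euc d → ℝ} {s : Set (Euc d)} (t : Euc d)
    (hf : IntegrableOn f ((fun x => x + t) ⁻¹' s)) : IntegrableOn (fun x => f (x - t)) s := by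
  have h := (measurePreserving_sub_right (volume : Measure (Euc d)) t).integrableOn_comp_preimage
    (measurableEmbedding_subRight t) (f := f) (s := (fun x => x + t) ⁻¹' s)
  have h2 : (fun x => x - t) ⁻¹' ((fun x => x + t) ⁻¹' s) = s := by ext; simp
  rw [h2] at h
  exact h.2 hf

lemma locallyIntegrable_of_ck_singularity (hd : 2 ≤ d) (hL : IsClosed (L : Set (Euc d)))
    {G Rt : Euc d → ℝ} (hGper : ∀ x, ∀ p ∈ L, G (x + p) = G x)
    (hGc : ContinuousOn G (L : Set (Euc d))ᶜ) {c δ : ℝ} (hδ : 0 < δ)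
    (hRt : ContinuousOn Rt (ball 0 δ))
    (hGsing : ∀ x : Euc d, x ≠ 0 → ‖x‖ < δ → G x = c * ck d x + Rt x) :
    LocallyIntegrable G volume := by
  intro x
  by_cases hx : x ∈ L
  · obtain ⟨ρ, hρ, hck⟩ := integrableOn_ck hd
    set r := min ρ (δ / 2) with hr
    have hr0 : 0 < r := by positivity
    have h0 : IntegrableOn G (ball 0 r) := by
      have h1 : IntegrableOn (fun y => c * ck d y + Rt y) (ball 0 r) := by
        refine Integrable.add ((hck.mono_set (ball_subset_ball (min_le_left _ _))).const_mul c) ?_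
        refine ((hRt.mono (closedBall_subset_ball (half_lt_self hδ))).integrableOn_compact
          (isCompact_closedBall _ _)).mono_set ?_
        exact (ball_subset_ball (min_le_right _ _)).trans ball_subset_closedBall
      refine h1.congr_fun_ae ?_
      have : Nontrivial (Euc d) := nontrivial_euc hd
      have h2 : ∀ᵐ y : Euc d, y ≠ 0 := by simp [ae_iff]
      filter_upwards [ae_restrict_of_ae h2, ae_restrict_mem measurableSet_ball] with y hy hyr
      refine (hGsing y hy ?_).symm
      have : ‖y‖ < r := by simpa using hyr
      linarith [min_le_right ρ (δ / 2)]
    have h1 : IntegrableOn (fun y => G (y - x)) (ball x r) :=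
      integrableOn_comp_sub x (by simpa using h0)
    refine ⟨ball x r, ball_mem_nhds x hr0, ?_⟩
    refine h1.congr_fun (fun y _ => ?_) measurableSet_ball
    simpa using (hGper (y - x) x hx).symm
  · obtain ⟨r, hr, hrL⟩ := Metric.nhds_basis_closedBall.mem_iff.1
      (hL.isOpen_compl.mem_nhds hx)
    exact ⟨closedBall x r, closedBall_mem_nhds x hr,
      (hGc.mono hrL).integrableOn_compact (isCompact_closedBall _ _)⟩

lemma integrableOn_comp_sub_of_locallyIntegrable {f : Euc d → ℝ} (hf : LocallyIntegrable f volume)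
    {s : Set (Euc d)} (hs : Bornology.IsBounded s) (t : Euc d) :
    IntegrableOn (fun x => f (x - t)) s := by
  obtain ⟨R, hR⟩ := hs.subset_closedBall 0
  refine IntegrableOn.mono_set (integrableOn_comp_sub t ?_) hR
  refine (hf.integrableOn_isCompact (isCompact_closedBall (-t) R)).mono_set ?_
  intro x hx
  simpa [dist_eq_norm] using hx

lemma sum_fderiv_fderiv_const_mul_sum {G : Euc d → ℝ}
    (hL : IsClosed (L : Set (Euc d)))
    (hG : ContDiffOn ℝ 2 G (L : Set (Euc d))ᶜ) {m : ℝ}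
    (hlap : ∀ x ∉ L, ∑ k, fderiv ℝ (fun z => fderiv ℝ G z (EuclideanSpace.single k (1:ℝ))) x
      (EuclideanSpace.single k (1:ℝ)) = m) (c : ℝ) {x : Euc d} (hx : x ∉ poles L a) :
    ∑ k, fderiv ℝ (fun z => fderiv ℝ (fun y => c * ∑ i, G (y - a i)) z
      (EuclideanSpace.single k (1:ℝ))) x (EuclideanSpace.single k (1:ℝ)) = c * ∑ _i : Fin N, m := by
  have hxi : ∀ i, ∀ᶠ z in 𝓝 x, z - a i ∉ L := by
    intro i
    have h1 : x - a i ∉ L := fun h => hx ⟨i, h⟩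
    have h2 : ContinuousAt (fun z => z - a i) x := by fun_prop
    exact h2.eventually (hL.isOpen_compl.mem_nhds h1)
  have hGd : ∀ y ∉ L, ContDiffAt ℝ 2 G y := fun y hy => hG.contDiffAt (hL.isOpen_compl.mem_nhds hy)
  have h1 : ∀ e : Euc d, (fun z => fderiv ℝ (fun y => c * ∑ i, G (y - a i)) z e) =ᶠ[𝓝 x]
      fun z => c * ∑ i, fderiv ℝ G (z - a i) e := by
    intro e
    filter_upwards [eventually_all.2 hxi] with z hz
    have h2 : ∀ i ∈ Finset.univ, HasFDerivAt (fun y => G (y - a i)) (fderiv ℝ G (z - a i)) z := by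
      intro i _
      have := ((hGd _ (hz i)).differentiableAt two_ne_zero).hasFDerivAt.comp z
        ((hasFDerivAt_id z).sub_const (a i))
      simpa [Function.comp_def] using this
    rw [((HasFDerivAt.fun_sum h2).const_mul c).fderiv]
    simp
  have h3 : ∀ e : Euc d, fderiv ℝ (fun z => fderiv ℝ (fun y => c * ∑ i, G (y - a i)) z e) x e
      = c * ∑ i, fderiv ℝ (fun z => fderiv ℝ G z e) (x - a i) e := by
    intro e
    rw [(h1 e).fderiv_eq]
    have h4 : ∀ i ∈ Finset.univ, HasFDerivAt (fun y => fderiv ℝ G (y - a i) e)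
        (fderiv ℝ (fun z => fderiv ℝ G z e) (x - a i)) x := by
      intro i _
      have h5 : DifferentiableAt ℝ (fun z => fderiv ℝ G z e) (x - a i) := by
        have := ((hGd _ (hxi i).self_of_nhds).fderiv_right (m := 1) (by norm_num)).differentiableAt
          one_ne_zero
        exact this.clm_apply (differentiableAt_const e)
      have := h5.hasFDerivAt.comp x ((hasFDerivAt_id x).sub_const (a i))
      simpa [Function.comp_def] using this
    rw [((HasFDerivAt.fun_sum h4).const_mul c).fderiv]
    simp
  simp_rw [h3]
  rw [← Finset.mul_sum, Finset.sum_comm]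
  congr 1
  exact Finset.sum_congr rfl fun i _ => hlap _ fun h => hx ⟨i, h⟩

lemma iUnion_ball_eq_setOf_infDist_lt (hN : 1 ≤ N) (η : ℝ) :
    (⋃ i : Fin N, ⋃ p ∈ (L : Set (Euc d)), ball (a i + p) η)
      = {x | infDist x (poles L a) < η} := by
  have hP : (poles L a).Nonempty := ⟨a ⟨0, hN⟩, self_mem_poles _⟩
  ext x
  simp only [Set.mem_iUnion, mem_ball, Set.mem_ofPred_eq, infDist_lt_iff hP, SetLike.mem_coe,
    exists_prop]
  constructor
  · rintro ⟨i, p, hp, hx⟩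
    exact ⟨a i + p, add_mem_poles (self_mem_poles i) hp, hx⟩
  · rintro ⟨y, ⟨i, hi⟩, hx⟩
    exact ⟨i, y - a i, hi, by simpa using hx⟩

end Lattice

/-- **The renormalized energy of periodic configurations.** Let `L` be a full-rank lattice of
covolume `N` with fundamental parallelepiped `D`, `G` the (normalized) Green function of the
torus `ℝ^d/L` — i.e. `L`-periodic, `C²` off `L`, `ΔG = 1/N` off `L`, mean zero on `D`, with a
logarithmic/power singularity `G = c_d^{−1} w + R̃` near `0` — and let `a_1, …, a_N` be points
which are pairwise distinct modulo `L`. Then for `h = c_d Σ_i G(·−a_i)`: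
`lim_{η→0} (∫_{D ∖ ⋃ B(a_i+v,η)} |∇h|² − N c_d w(η)) = c_d² Σ_{i≠j} G(a_i−a_j) + c_d² N R̃(0)`. -/
theorem renormalized_energy_periodic
    (d : ℕ) (hd : 2 ≤ d)
    (N : ℕ) (hN : 1 ≤ N)
    (v : Fin d → Euc d)
    (hcovol : |Matrix.det (Matrix.of fun i j : Fin d => v j i)| = (N : ℝ))
    (G : Euc d → ℝ)
    (hGper : ∀ (x : Euc d) (m : Fin d → ℤ), G (x + ∑ i, (m i : ℝ) • v i) = G x)
    (hGsmooth : ContDiffOn ℝ 2 G (lat d v)ᶜ)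
    (hGlap : ∀ x ∈ (lat d v)ᶜ,
      ∑ i : Fin d, fderiv ℝ (fun z => fderiv ℝ G z (EuclideanSpace.single i (1:ℝ))) x
        (EuclideanSpace.single i (1:ℝ)) = 1 / N)
    (hGmean : ∫ x in fundDomain d v, G x = 0)
    (δ : ℝ) (hδ : 0 < δ) (Rt : Euc d → ℝ)
    (hRt : ContDiffOn ℝ 1 Rt (ball (0 : Euc d) δ))
    (hGsing : ∀ x : Euc d, x ≠ 0 → ‖x‖ < δ → G x = (cConst d)⁻¹ * ck d x + Rt x)
    (a : Fin N → Euc d)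
    (hdistinct : ∀ i j : Fin N, i ≠ j → a i - a j ∉ lat d v) :
    Tendsto (fun η : ℝ =>
        (∫ x in fundDomain d v \ ⋃ i : Fin N, ⋃ p ∈ lat d v, ball (a i + p) η,
            ‖gradient (fun z => cConst d * ∑ i, G (z - a i)) x‖ ^ 2)
          - (N : ℝ) * cConst d * ckr d η)
      (𝓝[>] 0)
      (𝓝 (cConst d ^ 2 * (∑ i : Fin N, ∑ j : Fin N, if i ≠ j then G (a i - a j) else 0)
        + cConst d ^ 2 * N * Rt 0)) := by
  have hN0 : (N : ℝ) ≠ 0 := by positivity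
  obtain ⟨b, rfl⟩ := exists_basis_of_det_ne_zero (v := v)
    fun h => hN0 (by rw [← hcovol, h, abs_zero])
  rw [fundDomain_eq] at *
  rw [lat_eq_span] at *
  set L : AddSubgroup (Euc d) := (Submodule.span ℤ (Set.range b)).toAddSubgroup
  set D : Set (Euc d) := ZSpan.fundamentalDomain b
  have hD : IsAddFundamentalDomain L D volume := ZSpan.isAddFundamentalDomain' b volume
  have hDm : MeasurableSet D := ZSpan.fundamentalDomain_measurableSet b
  have hDb : Bornology.IsBounded D := ZSpan.fundamentalDomain_isBounded b
  have hLc : Countable L := inferInstanceAs (Countable (Submodule.span ℤ (Set.range b)))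
  have hdisc : DiscreteTopology L :=
    inferInstanceAs (DiscreteTopology (Submodule.span ℤ (Set.range b)))
  have hLclosed : IsClosed (L : Set (Euc d)) := AddSubgroup.isClosed_of_discrete
  have hGperL : ∀ x, ∀ p ∈ L, G (x + p) = G x := by
    intro x p hp
    have hp' : p ∈ lat d b := by rw [lat_eq_span]; exact hp
    obtain ⟨m, rfl⟩ := hp'
    exact hGper x m
  obtain ⟨r₀, hr₀, hsep⟩ := exists_poles_separated (L := L)
    (fun s hs => ZSpan.setFinite_inter b hs) a
  have hc := cConst_pos hd
  set c := cConst d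
  set h : Euc d → ℝ := fun z => c * ∑ i, G (z - a i) with hhdef
  have hGloc : LocallyIntegrable G volume :=
    locallyIntegrable_of_ck_singularity hd hLclosed hGperL hGsmooth.continuousOn hδ
      hRt.continuousOn hGsing
  have hGat : ∀ y ∉ L, ContDiffAt ℝ 2 G y := fun y hy =>
    hGsmooth.contDiffAt (hLclosed.isOpen_compl.mem_nhds hy)
  have hGi : ∀ i, IntegrableOn (fun z => G (z - a i)) D := fun i =>
    integrableOn_comp_sub_of_locallyIntegrable hGloc hDb (a i)
  have hh : ContDiffOn ℝ 2 h (poles L a)ᶜ := by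
    intro x hx
    refine (contDiffAt_const.mul (ContDiffAt.sum fun i _ => ?_)).contDiffWithinAt
    exact (hGat (x - a i) fun hi => hx ⟨i, hi⟩).comp x (contDiffAt_id.sub contDiffAt_const)
  have hhper : ∀ x, ∀ p ∈ L, h (x + p) = h x := by
    intro x p hp
    simp only [hhdef, add_sub_right_comm x p, hGperL _ p hp]
  have hint : IntegrableOn h D := (integrable_finsetSum _ fun i _ => hGi i).const_mul c
  have hmean : ∫ x in D, h x = 0 := by
    simp only [hhdef]
    rw [integral_const_mul, integral_finsetSum _ fun i _ => hGi i]
    have : ∀ i, ∫ x in D, G (x - a i) = 0 := fun i => by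
      simpa [sub_eq_add_neg, hGmean] using setIntegral_add_right_of_periodic hD hGperL (-a i)
    simp [this]
  set φ : Fin N → Euc d → ℝ := fun i x =>
    c * Rt (x - a i) + c * ∑ j ∈ Finset.univ.erase i, G (x - a j) with hφdef
  have hφ : ∀ i, ContDiffAt ℝ 1 (φ i) (a i) := by
    intro i
    refine (contDiffAt_const.mul ?_).add (contDiffAt_const.mul (ContDiffAt.sum fun j hj => ?_))
    · have h1 : ContDiffAt ℝ 1 Rt (a i - a i) :=
        hRt.contDiffAt (isOpen_ball.mem_nhds (by simpa using hδ))
      exact ContDiffAt.comp (f := fun x => x - a i) (a i) h1 (contDiffAt_id.sub contDiffAt_const)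
    · have h1 : ContDiffAt ℝ 1 G (a i - a j) :=
        (hGat _ (hdistinct i j (Finset.ne_of_mem_erase hj).symm)).of_le (by norm_num)
      exact ContDiffAt.comp (f := fun x => x - a j) (a i) h1 (contDiffAt_id.sub contDiffAt_const)
  have hhφ : ∀ i, ∀ᶠ x in 𝓝[≠] (a i), h x = ck d (x - a i) + φ i x := by
    intro i
    filter_upwards [self_mem_nhdsWithin, mem_nhdsWithin_of_mem_nhds (ball_mem_nhds (a i) hδ)]
      with x hx hxδ
    have hx1 := hGsing (x - a i) (sub_ne_zero.2 hx) (by simpa [dist_eq_norm] using hxδ)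
    simp only [hhdef, hφdef]
    rw [← Finset.add_sum_erase _ _ (Finset.mem_univ i), hx1]
    field_simp
    ring
  have key := tendsto_energy_sub hd hN hD hDm hDb hr₀ hsep hdistinct hh hhper
    (fun x hx => sum_fderiv_fderiv_const_mul_sum hLclosed hGsmooth hGlap c hx)
    hint hmean (fun i => φ i (a i))
    (fun i ε hε => eventually_flux_density_near_pole hd (hφ i) (hhφ i) hε)
  have hval : c * ∑ i, φ i (a i)
      = c ^ 2 * (∑ i : Fin N, ∑ j : Fin N, if i ≠ j then G (a i - a j) else 0)
        + c ^ 2 * N * Rt 0 := by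
    have h1 : ∀ i : Fin N, (∑ j : Fin N, if i ≠ j then G (a i - a j) else 0)
        = ∑ j ∈ Finset.univ.erase i, G (a i - a j) := by
      intro i
      rw [← Finset.sum_filter, Finset.filter_ne]
    simp only [h1, hφdef, sub_self, Finset.sum_add_distrib, ← Finset.mul_sum, Finset.sum_const,
      Finset.card_univ, Fintype.card_fin, nsmul_eq_mul]
    ring
  rw [← hval]
  simpa only [iUnion_ball_eq_setOf_infDist_lt hN] using key
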